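/- Let F₂ be the free group on two generators x, y, let F⁽¹⁾ = [F₂,F₂] be its commutator subgroup and F⁽²⁾ = [F⁽¹⁾,F⁽¹⁾]. If w ∈ F⁽¹⁾ and w ∉ F⁽²⁾, then the word map induced by w on PSL(2,ℂ) is surjective: for every c ∈ PSL(2,ℂ) there exist g, h ∈ PSL(2,ℂ) with w(g,h) = c. -/

import Mathlib

/-- The word map on a group `G` induced by a word `w` in the free group on two
generators: substitute `g` for the first generator and `h` for the second. -/
def wordMap {G : Type*} [Group G] (w : FreeGroup (Fin 2)) (g h : G) : G :=
  FreeGroup.lift ![g, h] w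

/-- The special linear group `SL(2,ℂ)`. -/
abbrev SL2C := Matrix.SpecialLinearGroup (Fin 2) ℂ

/-- The projective special linear group `PSL(2,ℂ) = SL(2,ℂ)/center`. -/
abbrev PSL2C := SL2C ⧸ Subgroup.center SL2C

open scoped commutatorElement

open Polynomial in
theorem wm_zpow_indep (a : ℂ) (ha : Transcendental ℤ a) (m : ℤ →₀ ℤ)
    (h : Finsupp.linearCombination ℤ (fun k : ℤ => a ^ k) m = 0) : m = 0 := by
  have ha0 : a ≠ 0 := by
    rintro rfl
    exact ha (isAlgebraic_zero)
  obtain ⟨K, hK⟩ : ∃ K : ℤ, ∀ k ∈ m.support, 0 ≤ k + K := by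
    refine ⟨∑ k ∈ m.support, |k|, fun k hk => ?_⟩
    have := Finset.single_le_sum (f := fun k : ℤ => |k|) (fun i _ => abs_nonneg i) hk
    have h2 := neg_abs_le k
    linarith
  set p : ℤ[X] := ∑ k ∈ m.support, Polynomial.monomial (k + K).toNat (m k) with hp
  have hev : Polynomial.aeval a p = 0 := by
    have : Polynomial.aeval a p = a ^ K * Finsupp.linearCombination ℤ (fun k : ℤ => a ^ k) m := by
      rw [hp, map_sum, Finsupp.linearCombination_apply, Finsupp.sum, Finset.mul_sum]
      refine Finset.sum_congr rfl fun k hk => ?_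
      rw [Polynomial.aeval_monomial, ← zpow_natCast, Int.toNat_of_nonneg (hK k hk),
        zpow_add₀ ha0]
      simp
      ring
    rw [this, h, mul_zero]
  have hp0 : p = 0 := by
    by_contra hne
    exact ha ⟨p, hne, hev⟩
  ext k
  by_contra hk
  have hk' : k ∈ m.support := by simpa using hk
  have hc : p.coeff (k + K).toNat = m k := by
    rw [hp, Polynomial.finsetSum_coeff, Finset.sum_eq_single k]
    · simp
    · intro b hb hbk
      rw [Polynomial.coeff_monomial, if_neg]
      intro h
      have h1 := hK k hk'
      have h2 := hK b hb
      omega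
    · intro h; exact absurd hk' h
  rw [hp0] at hc
  simp at hc
  exact hk (by simpa using hc.symm)

theorem wm_exists_transc : ∃ a : ℂ, Transcendental ℤ a := by
  have h := transcendental_liouvilleNumber (m := 2) le_rfl
  refine ⟨((liouvilleNumber 2 : ℝ) : ℂ), ?_⟩
  have := (transcendental_algebraMap_iff (R := ℤ) (S := ℝ) (A := ℂ)
    (algebraMap ℝ ℂ).injective (a := liouvilleNumber 2)).2 (by simpa using h)
  simpa using this

noncomputable def wmF (n : ℤ × ℤ →₀ ℤ) (a b : ℂ) : ℂ :=
  Finsupp.linearCombination ℤ (fun p : ℤ × ℤ => a ^ (2 * p.1) * b ^ (2 * p.2)) n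

theorem wm_nonvanish (n : ℤ × ℤ →₀ ℤ) (hn : n ≠ 0) :
    ∃ a b : ℂ, a ≠ 0 ∧ b ≠ 0 ∧ b ^ 2 ≠ 1 ∧ wmF n a b ≠ 0 ∧ wmF n a⁻¹ b⁻¹ ≠ 0 := by
  obtain ⟨a, ha⟩ := wm_exists_transc
  have ha0 : a ≠ 0 := by
    rintro rfl
    exact ha (isAlgebraic_zero)
  have ha' : Transcendental ℤ a⁻¹ := fun h => ha (by simpa using h.inv)
  obtain ⟨N, hN0, hN⟩ : ∃ N : ℤ, 0 < N ∧ ∀ p ∈ n.support, 2 * |p.1| < N := by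
    refine ⟨2 * ∑ p ∈ n.support, |p.1| + 1, ?_, fun p hp => ?_⟩
    · have : 0 ≤ ∑ p ∈ n.support, |p.1| := Finset.sum_nonneg fun i _ => abs_nonneg _
      omega
    · have := Finset.single_le_sum (f := fun p : ℤ × ℤ => |p.1|) (fun i _ => abs_nonneg _) hp
      omega
  set φ : ℤ × ℤ → ℤ := fun p => 2 * p.1 + N * (2 * p.2) with hφ
  have hinj : Set.InjOn φ (n.support : Set (ℤ × ℤ)) := by
    rintro ⟨i, j⟩ hp ⟨i', j'⟩ hq h
    have h1 := hN _ hp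
    have h2 := hN _ hq
    simp only [hφ] at h h1 h2
    have h3 : N * (j - j') = i' - i := by linarith
    have h4 : |i' - i| < N := by
      have := abs_sub i' i
      omega
    have h5 : j - j' = 0 := by
      by_contra hne
      have : 1 ≤ |j - j'| := Int.one_le_abs hne
      rw [← h3, abs_mul, abs_of_pos hN0] at h4
      nlinarith
    rw [h5] at h3
    ext <;> simp <;> omega
  have key : ∀ c : ℂ, Transcendental ℤ c → wmF n c (c ^ N) ≠ 0 := by
    intro c hc h
    have hc0 : c ≠ 0 := by
      rintro rfl
      exact hc (isAlgebraic_zero)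
    have h0 : Finsupp.mapDomain φ n = 0 := by
      apply wm_zpow_indep c hc
      rw [Finsupp.linearCombination_mapDomain, ← h, wmF]
      congr 2
      funext p
      simp only [Function.comp, hφ]
      rw [zpow_add₀ hc0, zpow_mul c N]
    apply hn
    have := Finsupp.mapDomain_injOn (M := ℤ) _ hinj
    exact this (x₁ := n) (x₂ := 0) (by simp) (by simp) (by simpa using h0)
  refine ⟨a, a ^ N, ha0, zpow_ne_zero _ ha0, ?_, key a ha, ?_⟩
  · intro h
    have : (Finsupp.single (N * 2) 1 - Finsupp.single 0 1 : ℤ →₀ ℤ) = 0 := by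
      apply wm_zpow_indep a ha
      rw [map_sub, Finsupp.linearCombination_single, Finsupp.linearCombination_single,
        zpow_mul]
      have h' : (a ^ N) ^ (2 : ℤ) = 1 := by exact_mod_cast h
      rw [h']; simp
    have h2 := DFunLike.congr_fun this 0
    simp [hN0.ne'] at h2
  · rw [← inv_zpow]
    exact key _ ha'

abbrev wmX : FreeGroup (Fin 2) := FreeGroup.of 0
abbrev wmY : FreeGroup (Fin 2) := FreeGroup.of 1

theorem wm_normalClosure :
    commutator (FreeGroup (Fin 2)) ≤ Subgroup.normalClosure {⁅wmX, wmY⁆} := by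
  set N := Subgroup.normalClosure {⁅wmX, wmY⁆} with hN
  have hxy : Commute (QuotientGroup.mk wmX : FreeGroup (Fin 2) ⧸ N) (QuotientGroup.mk wmY) := by
    rw [← commutatorElement_eq_one_iff_commute]
    have : ⁅wmX, wmY⁆ ∈ N := Subgroup.subset_normalClosure rfl
    exact (QuotientGroup.eq_one_iff _).2 this
  have h1 : ∀ i : Fin 2, ∀ q : FreeGroup (Fin 2),
      Commute (QuotientGroup.mk (FreeGroup.of i) : FreeGroup (Fin 2) ⧸ N) (QuotientGroup.mk q) := by
    intro i q
    induction q using FreeGroup.induction_on with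
    | C1 => exact Commute.one_right _
    | of j =>
      fin_cases i <;> fin_cases j
      · exact Commute.refl _
      · exact hxy
      · exact hxy.symm
      · exact Commute.refl _
    | inv_of j h => exact h.inv_right
    | mul p q hp hq => exact hp.mul_right hq
  have h2 : ∀ p q : FreeGroup (Fin 2),
      Commute (QuotientGroup.mk p : FreeGroup (Fin 2) ⧸ N) (QuotientGroup.mk q) := by
    intro p q
    induction p using FreeGroup.induction_on with
    | C1 => exact Commute.one_left _
    | of j => exact h1 j q
    | inv_of j h => exact h.inv_left
    | mul p q hp hq => exact hp.mul_left hq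
  rw [commutator_def, Subgroup.commutator_le]
  intro p _ q _
  rw [← QuotientGroup.eq_one_iff]
  exact commutatorElement_eq_one_iff_commute.2 (h2 p q)

/-- exponent sums -/
def wmE (i : Fin 2) : FreeGroup (Fin 2) →* Multiplicative ℤ :=
  FreeGroup.lift (fun j => Multiplicative.ofAdd (if j = i then 1 else 0))

theorem wm_abel (g : FreeGroup (Fin 2)) :
    ∃ k ∈ commutator (FreeGroup (Fin 2)),
      g = k * (wmX ^ (wmE 0 g).toAdd * wmY ^ (wmE 1 g).toAdd) := by
  have h : ∀ g : FreeGroup (Fin 2), Abelianization.of g =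
      (Abelianization.of wmX) ^ (wmE 0 g).toAdd * (Abelianization.of wmY) ^ (wmE 1 g).toAdd := by
    intro g
    induction g using FreeGroup.induction_on with
    | C1 => simp
    | of j => fin_cases j <;> simp [wmE]
    | inv_of j h => fin_cases j <;> simp [wmE]
    | mul p q hp hq =>
      rw [map_mul, hp, hq, map_mul (wmE 0), map_mul (wmE 1), toAdd_mul, toAdd_mul, zpow_add, zpow_add]
      exact mul_mul_mul_comm _ _ _ _
  refine ⟨g * (wmX ^ (wmE 0 g).toAdd * wmY ^ (wmE 1 g).toAdd)⁻¹, ?_, by group⟩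
  rw [← Abelianization.ker_of, MonoidHom.mem_ker, map_mul, map_inv, map_mul, map_zpow, map_zpow,
    ← h g, mul_inv_cancel]

def wmMk {R : Type*} [CommRing R] (A : Matrix (Fin 2) (Fin 2) R) (h : A.det = 1) :
    Matrix.SpecialLinearGroup (Fin 2) R := ⟨A, h⟩

@[simp] theorem wmMk_coe {R : Type*} [CommRing R] (A : Matrix (Fin 2) (Fin 2) R) (h : A.det = 1) :
    ((wmMk A h : Matrix.SpecialLinearGroup (Fin 2) R) : Matrix (Fin 2) (Fin 2) R) = A := rfl

theorem wm_ext {R : Type*} [CommRing R] {A B : Matrix.SpecialLinearGroup (Fin 2) R}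
    (h : (A : Matrix (Fin 2) (Fin 2) R) = B) : A = B := Subtype.ext h

noncomputable def wmG (a : ℂ) (ha : a ≠ 0) : SL2C := wmMk (!![a, 1; 0, a⁻¹]) (by simp [ha])
noncomputable def wmH (a : ℂ) (ha : a ≠ 0) : SL2C := wmMk (!![a, 0; 0, a⁻¹]) (by simp [ha])
noncomputable def wmU (v : ℂ) : SL2C := wmMk (!![1, v; 0, 1]) (by simp)

theorem wmU_mul (v v' : ℂ) : wmU v * wmU v' = wmU (v + v') := by
  ext i j; fin_cases i <;> fin_cases j <;> simp [wmU, Matrix.mul_apply, Fin.sum_univ_two, add_comm]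
theorem wmU_zero : wmU 0 = 1 := by
  ext i j; fin_cases i <;> fin_cases j <;> simp [wmU]
theorem wmU_inv (v : ℂ) : (wmU v)⁻¹ = wmU (-v) := by
  rw [inv_eq_iff_mul_eq_one, wmU_mul]; simp [wmU_zero]

theorem wm_upper (a b : ℂ) (ha : a ≠ 0) (hb : b ≠ 0) (g : FreeGroup (Fin 2)) :
    ∃ v, (FreeGroup.lift ![wmG a ha, wmH b hb] g : SL2C).1 =
      !![a ^ (wmE 0 g).toAdd * b ^ (wmE 1 g).toAdd, v; 0,
        (a ^ (wmE 0 g).toAdd * b ^ (wmE 1 g).toAdd)⁻¹] := by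
  induction g using FreeGroup.induction_on with
  | C1 => exact ⟨0, by ext i j; fin_cases i <;> fin_cases j <;> simp⟩
  | of j =>
    fin_cases j
    · exact ⟨1, by simp [wmE, wmG]⟩
    · exact ⟨0, by simp [wmE, wmH]⟩
  | inv_of j h =>
    fin_cases j
    · exact ⟨-1, by simp [wmE, wmG, Matrix.adjugate_fin_two]⟩
    · exact ⟨0, by simp [wmE, wmH, Matrix.adjugate_fin_two]⟩
  | mul p q hp hq =>
    obtain ⟨v, hv⟩ := hp
    obtain ⟨v', hv'⟩ := hq
    refine ⟨a ^ (wmE 0 p).toAdd * b ^ (wmE 1 p).toAdd * v' +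
      v * (a ^ (wmE 0 q).toAdd * b ^ (wmE 1 q).toAdd)⁻¹, ?_⟩
    · rw [map_mul, Matrix.SpecialLinearGroup.coe_mul, hv, hv']
      rw [map_mul (wmE 0), map_mul (wmE 1), toAdd_mul, toAdd_mul, zpow_add₀ ha, zpow_add₀ hb]
      ext i j
      fin_cases i <;> fin_cases j
      · simp [Matrix.mul_apply, Fin.sum_univ_two]; ring
      · simp [Matrix.mul_apply, Fin.sum_univ_two]
      · simp [Matrix.mul_apply, Fin.sum_univ_two]
      · simp [Matrix.mul_apply, Fin.sum_univ_two]; ring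

theorem wm_comm (a b : ℂ) (ha : a ≠ 0) (hb : b ≠ 0) :
    FreeGroup.lift ![wmG a ha, wmH b hb] ⁅wmX, wmY⁆ = wmU (a * (1 - b ^ 2)) := by
  rw [map_commutatorElement]
  rw [commutatorElement_def, mul_inv_eq_iff_eq_mul, mul_inv_eq_iff_eq_mul]
  ext i j
  fin_cases i <;> fin_cases j <;>
    simp [wmU, wmG, wmH, Matrix.mul_apply, Fin.sum_univ_two] <;> field_simp <;> ring

theorem wm_conj (a b : ℂ) (ha : a ≠ 0) (hb : b ≠ 0) (g : FreeGroup (Fin 2)) (u : ℂ) :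
    (FreeGroup.lift ![wmG a ha, wmH b hb] g : SL2C) * wmU u *
      (FreeGroup.lift ![wmG a ha, wmH b hb] g : SL2C)⁻¹ =
    wmU (u * (a ^ (2 * (wmE 0 g).toAdd) * b ^ (2 * (wmE 1 g).toAdd))) := by
  obtain ⟨v, hv⟩ := wm_upper a b ha hb g
  rw [mul_inv_eq_iff_eq_mul]
  apply wm_ext
  rw [Matrix.SpecialLinearGroup.coe_mul, Matrix.SpecialLinearGroup.coe_mul, hv]
  have h1 := zpow_ne_zero (wmE 0 g).toAdd ha
  have h2 := zpow_ne_zero (wmE 1 g).toAdd hb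
  rw [mul_comm 2, mul_comm 2, zpow_mul, zpow_mul]
  generalize a ^ (wmE 0 g).toAdd = s at *
  generalize b ^ (wmE 1 g).toAdd = t at *
  ext i j
  fin_cases i <;> fin_cases j
  · simp [wmU, Matrix.mul_apply, Fin.sum_univ_two]
  · simp [wmU, Matrix.mul_apply, Fin.sum_univ_two]
    field_simp
    norm_cast
    ring
  · simp [wmU, Matrix.mul_apply, Fin.sum_univ_two]
  · simp [wmU, Matrix.mul_apply, Fin.sum_univ_two]

abbrev wmD := commutator (FreeGroup (Fin 2))

theorem wm_c_mem (g : FreeGroup (Fin 2)) : g * ⁅wmX, wmY⁆ * g⁻¹ ∈ wmD :=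
  (inferInstance : wmD.Normal).conj_mem _
    (Subgroup.commutator_mem_commutator (Subgroup.mem_top _) (Subgroup.mem_top _)) g

noncomputable def wmPsi : (ℤ × ℤ →₀ ℤ) →ₗ[ℤ] Additive (Abelianization wmD) :=
  Finsupp.linearCombination ℤ (fun p => Additive.ofMul (Abelianization.of
    (⟨(wmX ^ p.1 * wmY ^ p.2) * ⁅wmX, wmY⁆ * (wmX ^ p.1 * wmY ^ p.2)⁻¹, wm_c_mem _⟩ : wmD)))

theorem wm_struct (w : FreeGroup (Fin 2)) (hw : w ∈ Subgroup.normalClosure {⁅wmX, wmY⁆}) :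
    ∃ (hw : w ∈ wmD) (n : ℤ × ℤ →₀ ℤ),
      Additive.ofMul (Abelianization.of (⟨w, hw⟩ : wmD)) = wmPsi n ∧
      ∀ a b : ℂ, ∀ (ha : a ≠ 0) (hb : b ≠ 0),
        FreeGroup.lift ![wmG a ha, wmH b hb] w = wmU (a * (1 - b ^ 2) * wmF n a b) := by
  induction hw using Subgroup.closure_induction with
  | mem w h =>
    rw [Group.mem_conjugatesOfSet_iff] at h
    obtain ⟨c, rfl, h⟩ := h
    obtain ⟨g, rfl⟩ := isConj_iff.1 h
    refine ⟨wm_c_mem g, Finsupp.single ((wmE 0 g).toAdd, (wmE 1 g).toAdd) 1, ?_, ?_⟩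
    · rw [wmPsi, Finsupp.linearCombination_single, one_smul]
      congr 1
      obtain ⟨k, hk, hg⟩ := wm_abel g
      generalize (wmE 0 g).toAdd = i at *
      generalize (wmE 1 g).toAdd = j at *
      subst hg
      have : (⟨k * (wmX ^ i * wmY ^ j) * ⁅wmX, wmY⁆ * (k * (wmX ^ i * wmY ^ j))⁻¹, wm_c_mem _⟩ : wmD)
        = ⟨k, hk⟩ * ⟨(wmX ^ i * wmY ^ j) * ⁅wmX, wmY⁆ * (wmX ^ i * wmY ^ j)⁻¹, wm_c_mem _⟩
          * ⟨k, hk⟩⁻¹ := by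
        apply Subtype.ext
        simp only [Subgroup.coe_mul, Subgroup.coe_inv, mul_inv_rev, mul_assoc]
      rw [this, map_mul, map_mul, map_inv, mul_comm (Abelianization.of _), mul_inv_cancel_right]
    · intro a b ha hb
      rw [map_mul, map_mul, map_inv, wm_comm, wm_conj]
      simp [wmF]
  | one =>
    refine ⟨one_mem _, 0, ?_, ?_⟩
    · rw [map_zero]; exact map_one Abelianization.of
    · intro a b ha hb
      simp [wmF, wmU_zero]
  | mul x y _ _ hx hy =>
    obtain ⟨hx, n, h1, h2⟩ := hx
    obtain ⟨hy, m, h3, h4⟩ := hy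
    refine ⟨mul_mem hx hy, n + m, ?_, ?_⟩
    · rw [map_add, ← h1, ← h3]; rfl
    · intro a b ha hb
      rw [map_mul, h2, h4, wmU_mul, wmF, wmF, wmF, map_add, mul_add]
  | inv x _ hx =>
    obtain ⟨hx, n, h1, h2⟩ := hx
    refine ⟨inv_mem hx, -n, ?_, ?_⟩
    · rw [map_neg, ← h1]; rfl
    · intro a b ha hb
      rw [map_inv, h2, wmU_inv, wmF, wmF, map_neg, mul_neg]

theorem wm_unip (w : FreeGroup (Fin 2)) (h1 : w ∈ wmD) (h2 : w ∉ ⁅wmD, wmD⁆) :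
    ∃ (a b : ℂ) (ha : a ≠ 0) (hb : b ≠ 0) (τ σ : ℂ), τ ≠ 0 ∧ σ ≠ 0 ∧
      FreeGroup.lift ![wmG a ha, wmH b hb] w = wmU τ ∧
      FreeGroup.lift ![wmG a⁻¹ (inv_ne_zero ha), wmH b⁻¹ (inv_ne_zero hb)] w = wmU σ := by
  obtain ⟨hw, n, hn, hF⟩ := wm_struct w (wm_normalClosure h1)
  have hn0 : n ≠ 0 := by
    rintro rfl
    rw [map_zero] at hn
    have h : Abelianization.of (⟨w, hw⟩ : wmD) = 1 := hn
    rw [← MonoidHom.mem_ker, Abelianization.ker_of] at h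
    apply h2
    rw [← Subgroup.map_subtype_commutator]
    exact ⟨_, h, rfl⟩
  obtain ⟨a, b, ha, hb, hb2, f1, f2⟩ := wm_nonvanish n hn0
  refine ⟨a, b, ha, hb, _, _, ?_, ?_, hF a b ha hb, hF _ _ _ _⟩
  · exact mul_ne_zero (mul_ne_zero ha (sub_ne_zero.2 hb2.symm)) f1
  · refine mul_ne_zero (mul_ne_zero (inv_ne_zero ha) (sub_ne_zero.2 ?_)) f2
    intro h
    apply hb2
    rw [inv_pow] at h
    exact inv_eq_one.1 h.symm

open Polynomial in
def wmRel (M N : Matrix.SpecialLinearGroup (Fin 2) ℂ[X]) : Prop :=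
  M 0 0 = N 1 1 ∧ M 1 1 = N 0 0 ∧ X * M 0 1 = N 1 0 ∧ M 1 0 = X * N 0 1

open Polynomial in
theorem wmRel_mul {M N M' N' : Matrix.SpecialLinearGroup (Fin 2) ℂ[X]} (h : wmRel M N)
    (h' : wmRel M' N') : wmRel (M * M') (N * N') := by
  obtain ⟨h1, h2, h3, h4⟩ := h
  obtain ⟨k1, k2, k3, k4⟩ := h'
  refine ⟨?_, ?_, ?_, ?_⟩ <;>
    simp only [Matrix.SpecialLinearGroup.coe_mul, Matrix.mul_apply, Fin.sum_univ_two]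
  · rw [h1, k1, ← h3, k4]; ring
  · rw [h2, k2, ← k3, h4]; ring
  · rw [← h3, ← k3, k2, h1]; ring
  · rw [k4, h4, k1, h2]; ring

open Polynomial in
theorem wmRel_inv {M N : Matrix.SpecialLinearGroup (Fin 2) ℂ[X]} (h : wmRel M N) :
    wmRel M⁻¹ N⁻¹ := by
  obtain ⟨h1, h2, h3, h4⟩ := h
  refine ⟨?_, ?_, ?_, ?_⟩ <;>
    simp [Matrix.SpecialLinearGroup.coe_inv, Matrix.adjugate_fin_two, *]

open Polynomial in
theorem wm_trace (w : FreeGroup (Fin 2)) (h1 : w ∈ wmD) (h2 : w ∉ ⁅wmD, wmD⁆) (t : ℂ) :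
    ∃ g h : SL2C, (FreeGroup.lift ![g, h] w : SL2C).1.trace = t := by
  obtain ⟨a, b, ha, hb, τ, σ, hτ, hσ, e1, e2⟩ := wm_unip w h1 h2
  let gM : Matrix.SpecialLinearGroup (Fin 2) ℂ[X] := wmMk (!![C a, 1; X, C a⁻¹ * (1 + X)]) (by
    rw [Matrix.det_fin_two_of, ← mul_assoc, ← C_mul, mul_inv_cancel₀ ha]; simp)
  let hM : Matrix.SpecialLinearGroup (Fin 2) ℂ[X] := wmMk (!![C b, 0; 0, C b⁻¹]) (by
    rw [Matrix.det_fin_two_of, ← C_mul, mul_inv_cancel₀ hb]; simp)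
  let gN : Matrix.SpecialLinearGroup (Fin 2) ℂ[X] := wmMk (!![C a⁻¹ * (1 + X), 1; X, C a]) (by
    rw [Matrix.det_fin_two_of, mul_right_comm, ← C_mul, inv_mul_cancel₀ ha]; simp)
  let hN : Matrix.SpecialLinearGroup (Fin 2) ℂ[X] := wmMk (!![C b⁻¹, 0; 0, C b]) (by
    rw [Matrix.det_fin_two_of, ← C_mul, inv_mul_cancel₀ hb]; simp)
  have hrel : wmRel (FreeGroup.lift ![gM, hM] w) (FreeGroup.lift ![gN, hN] w) := by
    have hg : ∀ j, wmRel (FreeGroup.lift ![gM, hM] (FreeGroup.of j))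
        (FreeGroup.lift ![gN, hN] (FreeGroup.of j)) := by
      intro j
      fin_cases j
      · simp [wmRel, gM, gN]
      · simp [wmRel, hM, hN]
    clear h1 h2 e1 e2
    induction w using FreeGroup.induction_on with
    | C1 => simp [wmRel]
    | of j => exact hg j
    | inv_of j h => rw [map_inv, map_inv]; exact wmRel_inv h
    | mul p q hp hq => rw [map_mul, map_mul]; exact wmRel_mul hp hq
  have hev : ∀ (z : ℂ) (g h : Matrix.SpecialLinearGroup (Fin 2) ℂ[X]),
      Matrix.SpecialLinearGroup.map (evalRingHom z) (FreeGroup.lift ![g, h] w) =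
      FreeGroup.lift ![Matrix.SpecialLinearGroup.map (evalRingHom z) g,
        Matrix.SpecialLinearGroup.map (evalRingHom z) h] w := by
    intro z g h
    rw [← MonoidHom.comp_apply]
    congr 1
    ext i
    fin_cases i <;> simp
  have hM0 := hev 0 gM hM
  have hN0 := hev 0 gN hN
  have q1 : Matrix.SpecialLinearGroup.map (evalRingHom 0) gM = wmG a ha := by
    ext i j; fin_cases i <;> fin_cases j <;> simp [gM, wmG]
  have q2 : Matrix.SpecialLinearGroup.map (evalRingHom 0) hM = wmH b hb := by
    ext i j; fin_cases i <;> fin_cases j <;> simp [hM, wmH]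
  have q3 : Matrix.SpecialLinearGroup.map (evalRingHom 0) gN = wmG a⁻¹ (inv_ne_zero ha) := by
    ext i j; fin_cases i <;> fin_cases j <;> simp [gN, wmG]
  have q4 : Matrix.SpecialLinearGroup.map (evalRingHom 0) hN = wmH b⁻¹ (inv_ne_zero hb) := by
    ext i j; fin_cases i <;> fin_cases j <;> simp [hN, wmH]
  rw [q1, q2, e1] at hM0
  rw [q3, q4, e2] at hN0
  have hevt := fun z => hev z gM hM
  clear hev
  set M := FreeGroup.lift ![gM, hM] w with hMdef
  set N := FreeGroup.lift ![gN, hN] w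
  obtain ⟨r1, r2, r3, r4⟩ := hrel
  have m00 : (M 0 0).eval 0 = 1 := by
    have := congrArg (fun A : SL2C => A 0 0) hM0
    simpa [wmU] using this
  have m11 : (M 1 1).eval 0 = 1 := by
    have := congrArg (fun A : SL2C => A 1 1) hM0
    simpa [wmU] using this
  have m01 : (M 0 1).eval 0 = τ := by
    have := congrArg (fun A : SL2C => A 0 1) hM0
    simpa [wmU] using this
  have n01 : (N 0 1).eval 0 = σ := by
    have := congrArg (fun A : SL2C => A 0 1) hN0
    simpa [wmU] using this
  have hdet : M 0 0 * M 1 1 - M 0 1 * M 1 0 = 1 := by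
    have := M.2
    rwa [Matrix.det_fin_two] at this
  set P : ℂ[X] := M 0 0 + M 1 1 - C t with hP
  have hdeg : P.degree ≠ 0 := by
    intro hdeg
    obtain ⟨r, hr⟩ : ∃ r, M 0 0 + M 1 1 = C r := by
      refine ⟨P.coeff 0 + t, ?_⟩
      have := eq_C_of_degree_eq_zero hdeg
      rw [C_add, ← this, hP]; ring
    have hr2 : r = 2 := by
      have := congrArg (eval 0) hr
      rw [eval_add, m00, m11, eval_C] at this
      rw [← this]; norm_num
    have hsum : M 1 1 = 2 - M 0 0 := by
      rw [hr2] at hr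
      have : (C 2 : ℂ[X]) = 2 := rfl
      rw [← this, ← hr]; ring
    have hX : X ∣ M 0 0 - 1 := by
      rw [X_dvd_iff, coeff_zero_eq_eval_zero, eval_sub, m00]; simp
    obtain ⟨s, hs⟩ := hX
    have hs' : M 0 0 = 1 + X * s := by rw [← hs]; ring
    rw [hsum, r4, hs'] at hdet
    have h3 : X * (M 0 1 * N 0 1) = X * (- (X * s ^ 2)) := by
      linear_combination -hdet
    have h4 := mul_left_cancel₀ X_ne_zero h3
    have h5 := congrArg (eval 0) h4
    rw [eval_mul, m01, n01] at h5
    simp at h5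
    tauto
  obtain ⟨z, hz⟩ := IsAlgClosed.exists_root P hdeg
  refine ⟨Matrix.SpecialLinearGroup.map (evalRingHom z) gM, Matrix.SpecialLinearGroup.map (evalRingHom z) hM, ?_⟩
  rw [← hevt z]
  have hz' : (M 0 0).eval z + (M 1 1).eval z - t = 0 := by
    simpa [hP, IsRoot] using hz
  rw [Matrix.trace_fin_two]
  have : (M 0 0).eval z + (M 1 1).eval z = t := by linear_combination hz'
  simpa using this

def wmScalar (M : SL2C) : Prop := M 0 1 = 0 ∧ M 1 0 = 0 ∧ M 0 0 = M 1 1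

theorem wm_companion (M : SL2C) (hM : ¬ wmScalar M) :
    ∃ P : SL2C, M.1 * P.1 = P.1 * !![0, -1; 1, M.1.trace] := by
  obtain ⟨x, y, hd⟩ : ∃ x y : ℂ,
      x * (M 1 0 * x + M 1 1 * y) - (M 0 0 * x + M 0 1 * y) * y ≠ 0 := by
    by_contra! hc
    apply hM
    have c1 := hc 1 0
    have c2 := hc 0 1
    have c3 := hc 1 1
    refine ⟨by linear_combination -c2, by linear_combination c1,
      by linear_combination c1 + c2 - c3⟩
  set d := x * (M 1 0 * x + M 1 1 * y) - (M 0 0 * x + M 0 1 * y) * y with hdd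
  obtain ⟨e, he⟩ := IsAlgClosed.exists_pow_nat_eq (d⁻¹) (n := 2) (by norm_num)
  have hed : e ^ 2 * d = 1 := by rw [he]; exact inv_mul_cancel₀ hd
  have hdet : M 0 0 * M 1 1 - M 0 1 * M 1 0 = 1 := by
    have := M.2
    rwa [Matrix.det_fin_two] at this
  refine ⟨wmMk !![e * x, e * (M 0 0 * x + M 0 1 * y); e * y, e * (M 1 0 * x + M 1 1 * y)] ?_, ?_⟩
  · rw [Matrix.det_fin_two_of]
    linear_combination hed
  · rw [Matrix.trace_fin_two]
    ext i j
    fin_cases i <;> fin_cases j <;> simp [Matrix.mul_apply, Fin.sum_univ_two]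
    · ring
    · linear_combination (-e * x) * hdet
    · ring
    · linear_combination (-e * y) * hdet

theorem wm_isConj (M N : SL2C) (hM : ¬ wmScalar M) (hN : ¬ wmScalar N)
    (h : M.1.trace = N.1.trace) : ∃ P : SL2C, P * M * P⁻¹ = N := by
  obtain ⟨P, hP⟩ := wm_companion M hM
  obtain ⟨Q, hQ⟩ := wm_companion N hN
  let K : SL2C := wmMk (!![0, -1; 1, M.1.trace]) (by simp)
  have h1 : M * P = P * K := wm_ext (by simpa [K] using hP)
  have h2 : N * Q = Q * K := wm_ext (by simpa [K, h] using hQ)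
  refine ⟨Q * P⁻¹, ?_⟩
  have h3 : M = P * K * P⁻¹ := by rw [← h1]; group
  have h4 : N = Q * K * Q⁻¹ := by rw [← h2]; group
  rw [h3, h4]; group

theorem wm_scalar_center (M : SL2C) (h : wmScalar M) : M ∈ Subgroup.center SL2C := by
  rw [Matrix.SpecialLinearGroup.mem_center_iff]
  have hdet : M 0 0 * M 1 1 - M 0 1 * M 1 0 = 1 := by
    have := M.2
    rwa [Matrix.det_fin_two] at this
  obtain ⟨h1, h2, h3⟩ := h
  refine ⟨M 0 0, ?_, ?_⟩
  · rw [h1, ← h3] at hdet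
    rw [Fintype.card_fin]
    linear_combination hdet
  · ext i j
    fin_cases i <;> fin_cases j <;> simp [h1, h2, h3]

theorem wm_lift {G H : Type*} [Group G] [Group H] (f : G →* H) (w : FreeGroup (Fin 2)) (g h : G) :
    f (wordMap w g h) = wordMap w (f g) (f h) := by
  unfold wordMap
  rw [← MonoidHom.comp_apply]
  congr 1
  ext i
  fin_cases i <;> simp

/-- Nonscalar matrices of trace different from `-2` are values of the word map on `SL(2,ℂ)`. -/
theorem wm_main (w : FreeGroup (Fin 2)) (h1 : w ∈ wmD) (h2 : w ∉ ⁅wmD, wmD⁆) (M : SL2C)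
    (hM : ¬ wmScalar M) (ht : M.1.trace ≠ -2) : ∃ g h : SL2C, wordMap w g h = M := by
  suffices ∃ g h : SL2C, ¬ wmScalar (wordMap w g h) ∧ (wordMap w g h).1.trace = M.1.trace by
    obtain ⟨g, h, hs, htr⟩ := this
    obtain ⟨P, hP⟩ := wm_isConj _ _ hs hM htr
    refine ⟨P * g * P⁻¹, P * h * P⁻¹, ?_⟩
    rw [← hP]
    exact (wm_lift (MulAut.conj P).toMonoidHom w g h).symm
  by_cases ht2 : M.1.trace = 2
  · obtain ⟨a, b, ha, hb, τ, σ, hτ, hσ, e1, e2⟩ := wm_unip w h1 h2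
    refine ⟨wmG a ha, wmH b hb, ?_, ?_⟩
    · rw [wordMap, e1]
      rintro ⟨h, -⟩
      exact hτ (by simpa [wmU] using h)
    · rw [wordMap, e1, ht2, Matrix.trace_fin_two]
      simp [wmU]; norm_num
  · obtain ⟨g, h, hgh⟩ := wm_trace w h1 h2 M.1.trace
    refine ⟨g, h, ?_, hgh⟩
    rintro ⟨k1, k2, k3⟩
    change (wordMap w g h).1.trace = _ at hgh
    set A := wordMap w g h
    have hdet : A 0 0 * A 1 1 - A 0 1 * A 1 0 = 1 := by
      have := A.2
      rwa [Matrix.det_fin_two] at this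
    rw [Matrix.trace_fin_two] at hgh
    change A 0 0 + A 1 1 = _ at hgh
    rw [k1, ← k3] at hdet
    rw [← k3] at hgh
    have : (M.1.trace - 2) * (M.1.trace + 2) = 0 := by
      rw [← hgh]; linear_combination 4 * hdet
    rcases mul_eq_zero.1 this with h | h
    · exact ht2 (sub_eq_zero.1 h)
    · exact ht (eq_neg_of_add_eq_zero_left h)

theorem word_map_surjective_of_in_derived_not_second_derived
    (w : FreeGroup (Fin 2))
    (h1 : w ∈ commutator (FreeGroup (Fin 2)))
    (h2 : w ∉ ⁅commutator (FreeGroup (Fin 2)), commutator (FreeGroup (Fin 2))⁆) :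
    ∀ c : PSL2C, ∃ g h : PSL2C, wordMap w g h = c := by
  intro c
  obtain ⟨M, rfl⟩ := QuotientGroup.mk_surjective c
  by_cases hM : wmScalar M
  · refine ⟨1, 1, ?_⟩
    rw [(QuotientGroup.eq_one_iff M).2 (wm_scalar_center M hM)]
    have := wm_lift (1 : PSL2C →* PSL2C) w 1 1
    simpa using this.symm
  suffices ∃ g h : SL2C, (QuotientGroup.mk (wordMap w g h) : PSL2C) = QuotientGroup.mk M by
    obtain ⟨g, h, hgh⟩ := this
    refine ⟨QuotientGroup.mk g, QuotientGroup.mk h, ?_⟩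
    rw [← hgh]
    exact (wm_lift (QuotientGroup.mk' (Subgroup.center SL2C)) w g h).symm
  by_cases ht : M.1.trace = -2
  · have hM' : ¬ wmScalar (-M) := by
      rintro ⟨k1, k2, k3⟩
      apply hM
      refine ⟨by simpa using k1, by simpa using k2, by simpa using k3⟩
    obtain ⟨g, h, hgh⟩ := wm_main w h1 h2 (-M) hM' (by
      rw [Matrix.SpecialLinearGroup.coe_neg, Matrix.trace_neg, ht]; norm_num)
    refine ⟨g, h, ?_⟩
    rw [hgh, QuotientGroup.eq]
    apply wm_scalar_center
    have : (-M)⁻¹ * M = -1 := by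
      rw [inv_mul_eq_iff_eq_mul]; simp
    rw [this]
    simp [wmScalar]
  · obtain ⟨g, h, hgh⟩ := wm_main w h1 h2 M hM ht
    exact ⟨g, h, by rw [hgh]⟩
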